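/- For every two-person chess-like game and every real-valued zero-sum payoff (not necessarily ±1-valued), a saddle point in pure stationary strategies exists from every initial position; equivalently, zero-sum solvability of two-person chess-like positional game forms follows from their ±1-solvability. -/

import Mathlib

/-! Two-person chess-like games: a finite digraph `(V, edge)` whose vertices are
partitioned, via `owner : V → Option (Fin 2)`, into positions of player 0,
positions of player 1 and terminals (`owner v = none`), the terminals being
exactly the vertices without outgoing edges.  All directed cycles form one
outcome `c`, encoded as `none : Option V`; a terminal `t` is the outcome
`some t`.  Strategies are pure and stationary. -/

section ChessLike

variable {V : Type*} [Fintype V] [DecidableEq V]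

/-- One step of the play under the profile `s` (terminals are fixed points). -/
def gstep (owner : V → Option (Fin 2)) (s : Fin 2 → V → V) (v : V) : V :=
  match owner v with
  | none => v
  | some i => s i v

/-- Outcome of the play from `v₀` under the profile `s`: after `|V|` steps the
play has either reached a terminal (outcome `some` that terminal) or it repeats
a non-terminal position and hence cycles forever (outcome `none`, i.e. `c`). -/
def gOutcome (owner : V → Option (Fin 2)) (s : Fin 2 → V → V) (v0 : V) : Option V :=
  match owner ((gstep owner s)^[Fintype.card V] v0), (gstep owner s)^[Fintype.card V] v0 with
  | none, w => some w
  | some _, _ => none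

/-- `t` is a valid strategy of player `i`: it selects an outgoing edge at every
position of player `i`. -/
def ValidFor (edge : V → V → Prop) (owner : V → Option (Fin 2)) (i : Fin 2)
    (t : V → V) : Prop :=
  ∀ v, owner v = some i → edge v (t v)

end ChessLike

theorem Function.iterate_card_eq_of_isFixedPt {V : Type*} [Fintype V] (f : V → V) (v : V) (n : ℕ)
    (h : f (f^[n] v) = f^[n] v) : f^[Fintype.card V] v = f^[n] v := by
  have hfix : ∀ m, n ≤ m → f^[m] v = f^[n] v := by
    intro m hm
    obtain ⟨k, rfl⟩ := Nat.exists_eq_add_of_le' hm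
    rw [Function.iterate_add_apply]
    exact Function.iterate_fixed h k
  obtain ⟨a, b, hab, heq⟩ := Fintype.exists_ne_map_eq_of_card_lt
    (fun k : Fin (Fintype.card V + 1) => f^[(k : ℕ)] v) (by simp)
  wlog hlt : a < b generalizing a b
  · exact this b a hab.symm heq.symm (lt_of_le_of_ne (not_lt.mp hlt) hab.symm)
  have hlt' : (a : ℕ) < b := hlt
  obtain ⟨p, hp⟩ := Nat.exists_eq_add_of_lt hlt'
  have hper : ∀ k, f^[k * (p + 1) + a] v = f^[(a : ℕ)] v := by
    intro k
    induction k with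
    | zero => simp
    | succ k ih =>
      rw [show (k + 1) * (p + 1) + (a : ℕ) = k * (p + 1) + b by rw [hp]; ring,
        Function.iterate_add_apply]
      change f^[(a : ℕ)] v = f^[(b : ℕ)] v at heq
      rw [← heq, ← Function.iterate_add_apply, ih]
  have hx : f^[(a : ℕ)] v = f^[n] v := by
    rw [← hper n]
    exact hfix _ (by nlinarith)
  obtain ⟨k, hk⟩ := Nat.exists_eq_add_of_le' (Nat.lt_succ_iff.mp a.2)
  rw [hk, Function.iterate_add_apply, hx]
  exact Function.iterate_fixed h k

section Attractor

variable {V : Type*}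

/-- The positions from which player `i` can force a visit to `T` within `n` steps. -/
def attractor (edge : V → V → Prop) (owner : V → Option (Fin 2)) (i : Fin 2) (T : Set V) :
    ℕ → Set V
  | 0 => T
  | n + 1 => {v | v ∈ attractor edge owner i T n ∨
      (owner v = some i ∧ ∃ w, edge v w ∧ w ∈ attractor edge owner i T n) ∨
      (∃ j, j ≠ i ∧ owner v = some j ∧ ∀ w, edge v w → w ∈ attractor edge owner i T n)}

theorem attractor_mono (edge : V → V → Prop) (owner : V → Option (Fin 2)) (i : Fin 2)
    (T : Set V) : Monotone (attractor edge owner i T) :=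
  monotone_nat_of_le_succ fun _ _ hv => Or.inl hv

theorem exists_validFor {edge : V → V → Prop} {owner : V → Option (Fin 2)}
    (hterm : ∀ v, owner v = none ↔ ∀ w, ¬ edge v w) (i : Fin 2) (P : V → V → Prop)
    (hP : ∀ v, owner v = some i → (∃ w, P v w) → ∃ w, edge v w ∧ P v w) :
    ∃ t, ValidFor edge owner i t ∧ ∀ v, owner v = some i → (∃ w, P v w) → P v (t v) := by
  have key : ∀ v, ∃ w, owner v = some i → edge v w ∧ ((∃ w, P v w) → P v w) := by
    intro v
    by_cases ho : owner v = some i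
    · by_cases hw : ∃ w, P v w
      · obtain ⟨w, hw, hPw⟩ := hP v ho hw
        exact ⟨w, fun _ => ⟨hw, fun _ => hPw⟩⟩
      · have hn : ¬ ∀ w, ¬ edge v w := by rw [← hterm, ho]; simp
        push Not at hn
        obtain ⟨w, he⟩ := hn
        exact ⟨w, fun _ => ⟨he, fun h => absurd h hw⟩⟩
    · exact ⟨v, fun h => absurd h ho⟩
  choose t ht using key
  exact ⟨t, fun v hv => (ht v hv).1, fun v hv => (ht v hv).2⟩

theorem exists_attracting_strategy {edge : V → V → Prop} {owner : V → Option (Fin 2)}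
    (hterm : ∀ v, owner v = none ↔ ∀ w, ¬ edge v w) (i : Fin 2) (T : Set V) :
    ∃ t, ValidFor edge owner i t ∧ ∀ s : Fin 2 → V → V, s i = t →
      (∀ j, j ≠ i → ValidFor edge owner j (s j)) →
      ∀ n, ∀ v ∈ attractor edge owner i T n, ∃ k, (gstep owner s)^[k] v ∈ T := by
  classical
  obtain ⟨t, ht, htP⟩ := exists_validFor hterm i
    (fun v w => ∃ n, v ∉ attractor edge owner i T n ∧ v ∈ attractor edge owner i T (n + 1) ∧
      edge v w ∧ w ∈ attractor edge owner i T n)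
    (fun v _ ⟨w, n, h1, h2, h3, h4⟩ => ⟨w, h3, n, h1, h2, h3, h4⟩)
  refine ⟨t, ht, fun s hs hv n => ?_⟩
  induction n with
  | zero => exact fun v hvT => ⟨0, hvT⟩
  | succ n ih =>
    intro v hvA
    by_cases hvn : v ∈ attractor edge owner i T n
    · exact ih v hvn
    suffices hstep : gstep owner s v ∈ attractor edge owner i T n by
      obtain ⟨k, hk⟩ := ih _ hstep
      exact ⟨k + 1, hk⟩
    rcases hvA with h | ⟨ho, w, he, hw⟩ | ⟨j, hj, ho, hall⟩
    · exact absurd h hvn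
    · obtain ⟨m, h1, h2, -, h4⟩ :=
        htP v ho ⟨w, n, hvn, Or.inr (Or.inl ⟨ho, w, he, hw⟩), he, hw⟩
      have hmn : m ≤ n := by
        by_contra hlt
        exact h1 (attractor_mono edge owner i T (show n + 1 ≤ m by omega)
          (Or.inr (Or.inl ⟨ho, w, he, hw⟩)))
      simp only [gstep, ho, hs]
      exact attractor_mono edge owner i T hmn h4
    · simp only [gstep, ho]
      exact hall _ (hv j hj v ho)

theorem exists_avoiding_strategy [Fintype V] {edge : V → V → Prop} {owner : V → Option (Fin 2)}
    (hterm : ∀ v, owner v = none ↔ ∀ w, ¬ edge v w) {i j : Fin 2} (hij : i ≠ j) (T : Set V) :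
    ∃ t, ValidFor edge owner j t ∧ ∀ s : Fin 2 → V → V, s j = t →
      ValidFor edge owner i (s i) →
      ∀ v, (∀ n, v ∉ attractor edge owner i T n) →
        ∀ k, (gstep owner s)^[k] v ∉ T := by
  obtain ⟨t, ht, htP⟩ := exists_validFor hterm j
    (fun v w => edge v w ∧ ∀ n, w ∉ attractor edge owner i T n)
    (fun v _ ⟨w, h1, h2⟩ => ⟨w, h1, h1, h2⟩)
  refine ⟨t, ht, fun s hs hi v hv k => ?_⟩
  suffices h : ∀ n, (gstep owner s)^[k] v ∉ attractor edge owner i T n from h 0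
  induction k generalizing v with
  | zero => exact hv
  | succ k ih =>
    rw [Function.iterate_succ_apply]
    apply ih
    rcases ho : owner v with _ | l
    · simpa only [gstep, ho] using hv
    · simp only [gstep, ho]
      by_cases hl : l = i
      · subst hl
        exact fun n hn => hv (n + 1) (Or.inr (Or.inl ⟨ho, _, hi v ho, hn⟩))
      · obtain rfl : l = j := by omega
        rw [hs]
        refine (htP v ho ?_).2
        by_contra! hcon
        have hrank : ∀ w, ∃ n, edge v w → w ∈ attractor edge owner i T n := by
          intro w
          by_cases he : edge v w
          · obtain ⟨n, hn⟩ := hcon w he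
            exact ⟨n, fun _ => hn⟩
          · exact ⟨0, fun h => absurd h he⟩
        choose r hr using hrank
        exact hv (Finset.univ.sup r + 1) (Or.inr (Or.inr ⟨l, hl, ho, fun w he =>
          attractor_mono edge owner i T (Finset.le_sup (Finset.mem_univ w)) (hr w he)⟩))

end Attractor

section Determinacy

variable {V : Type*} [Fintype V]

theorem gOutcome_eq_some_iff {owner : V → Option (Fin 2)} {s : Fin 2 → V → V} {v x : V} :
    gOutcome owner s v = some x ↔
      owner x = none ∧ (gstep owner s)^[Fintype.card V] v = x := by
  unfold gOutcome
  generalize (gstep owner s)^[Fintype.card V] v = y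
  rcases ho : owner y with _ | l
  · simp only [Option.some.injEq]
    exact ⟨fun h => ⟨h ▸ ho, h⟩, fun h => h.2⟩
  · simp only [reduceCtorEq, false_iff]
    rintro ⟨h, rfl⟩
    simp [h] at ho

theorem reachability_determined {edge : V → V → Prop} {owner : V → Option (Fin 2)}
    (hterm : ∀ v, owner v = none ↔ ∀ w, ¬ edge v w) {i j : Fin 2} (hij : i ≠ j)
    {T : Set V} (hT : ∀ x ∈ T, owner x = none) (v0 : V) :
    (∃ t, ValidFor edge owner i t ∧ ∀ s : Fin 2 → V → V, s i = t →
      ValidFor edge owner j (s j) → ∃ x ∈ T, gOutcome owner s v0 = some x) ∨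
    (∃ t, ValidFor edge owner j t ∧ ∀ s : Fin 2 → V → V, s j = t →
      ValidFor edge owner i (s i) → ∀ x ∈ T, gOutcome owner s v0 ≠ some x) := by
  by_cases h : ∃ n, v0 ∈ attractor edge owner i T n
  · left
    obtain ⟨n, hn⟩ := h
    obtain ⟨t, ht, hreach⟩ := exists_attracting_strategy hterm i T
    refine ⟨t, ht, fun s hs hj => ?_⟩
    obtain ⟨k, hk⟩ := hreach s hs
      (fun l hl => by obtain rfl : l = j := by omega
                      exact hj) n v0 hn
    refine ⟨_, hk, gOutcome_eq_some_iff.2 ⟨hT _ hk, ?_⟩⟩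
    apply Function.iterate_card_eq_of_isFixedPt
    simp only [gstep, hT _ hk]
  · right
    push Not at h
    obtain ⟨t, ht, havoid⟩ := exists_avoiding_strategy hterm hij T
    refine ⟨t, ht, fun s hs hi x hx ho => ?_⟩
    exact havoid s hs hi v0 h (Fintype.card V) ((gOutcome_eq_some_iff.1 ho).2 ▸ hx)

theorem threshold_determined {edge : V → V → Prop} {owner : V → Option (Fin 2)}
    (hterm : ∀ v, owner v = none ↔ ∀ w, ¬ edge v w) (u : Option V → ℝ) (v0 : V) (r : ℝ) :
    (∃ t, ValidFor edge owner 0 t ∧ ∀ s : Fin 2 → V → V, s 0 = t →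
      ValidFor edge owner 1 (s 1) → r ≤ u (gOutcome owner s v0)) ∨
    (∃ t, ValidFor edge owner 1 t ∧ ∀ s : Fin 2 → V → V, s 1 = t →
      ValidFor edge owner 0 (s 0) → u (gOutcome owner s v0) < r) := by
  by_cases hr : u none < r
  · refine (reachability_determined hterm (show (0 : Fin 2) ≠ 1 by decide)
      (T := {x | owner x = none ∧ r ≤ u (some x)}) (fun x hx => hx.1) v0).imp ?_ ?_
    · rintro ⟨t, ht, h⟩
      refine ⟨t, ht, fun s hs hv => ?_⟩
      obtain ⟨x, hx, ho⟩ := h s hs hv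
      exact ho ▸ hx.2
    · rintro ⟨t, ht, h⟩
      refine ⟨t, ht, fun s hs hv => ?_⟩
      rcases ho : gOutcome owner s v0 with _ | x
      · exact hr
      · by_contra hlt
        exact h s hs hv x ⟨(gOutcome_eq_some_iff.1 ho).1, not_lt.mp hlt⟩ ho
  · refine (reachability_determined hterm (show (1 : Fin 2) ≠ 0 by decide)
      (T := {x | owner x = none ∧ u (some x) < r}) (fun x hx => hx.1) v0).symm.imp ?_ ?_
    · rintro ⟨t, ht, h⟩
      refine ⟨t, ht, fun s hs hv => ?_⟩
      rcases ho : gOutcome owner s v0 with _ | x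
      · exact not_lt.mp hr
      · by_contra hlt
        exact h s hs hv x ⟨(gOutcome_eq_some_iff.1 ho).1, not_le.mp hlt⟩ ho
    · rintro ⟨t, ht, h⟩
      refine ⟨t, ht, fun s hs hv => ?_⟩
      obtain ⟨x, hx, ho⟩ := h s hs hv
      exact ho ▸ hx.2

end Determinacy

/-- for every two-person chess-like game and every real-valued
zero-sum payoff (given by player 0's payoff `u` on outcomes, player 1's payoff
being `-u`), a saddle point in pure stationary strategies exists from every
initial position. -/
theorem chess_like_zero_sum_solvable
    {V : Type*} [Fintype V] [DecidableEq V]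
    (edge : V → V → Prop) (owner : V → Option (Fin 2))
    (hterm : ∀ v, owner v = none ↔ ∀ w, ¬ edge v w)
    (u : Option V → ℝ) (v0 : V) :
    ∃ s : Fin 2 → V → V, (∀ j, ValidFor edge owner j (s j)) ∧
      (∀ t : V → V, ValidFor edge owner 0 t →
        u (gOutcome owner (Function.update s 0 t) v0) ≤ u (gOutcome owner s v0)) ∧
      (∀ t : V → V, ValidFor edge owner 1 t →
        u (gOutcome owner s v0) ≤ u (gOutcome owner (Function.update s 1 t) v0)) := by
  classical
  obtain ⟨σ₀, hσ₀, -⟩ := exists_validFor hterm 0 (fun _ _ => False) (by simp)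
  obtain ⟨τ₀, hτ₀, -⟩ := exists_validFor hterm 1 (fun _ _ => False) (by simp)
  let G : Option V → Prop := fun o => ∃ t, ValidFor edge owner 0 t ∧
    ∀ s : Fin 2 → V → V, s 0 = t → ValidFor edge owner 1 (s 1) → u o ≤ u (gOutcome owner s v0)
  obtain ⟨m, hm⟩ := Finite.exists_min u
  obtain ⟨o, ho, hmax⟩ := Set.exists_max_image {o | G o} u (Set.toFinite _)
    ⟨m, σ₀, hσ₀, fun s _ _ => hm _⟩
  obtain ⟨σ, hσ, hσu⟩ := ho
  obtain ⟨τ, hτ, hτu⟩ : ∃ t, ValidFor edge owner 1 t ∧ ∀ s : Fin 2 → V → V, s 1 = t →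
      ValidFor edge owner 0 (s 0) → u (gOutcome owner s v0) ≤ u o := by
    by_cases hne : {p | u o < u p}.Nonempty
    · obtain ⟨p, hp, hmin⟩ := Set.exists_min_image {p | u o < u p} u (Set.toFinite _) hne
      rcases threshold_determined hterm u v0 (u p) with h | ⟨t, ht, h⟩
      · exact absurd (hmax p h) (not_le.mpr hp)
      · refine ⟨t, ht, fun s hs hv => ?_⟩
        by_contra hlt
        exact absurd (h s hs hv) (not_lt.mpr (hmin _ (not_le.mp hlt)))
    · exact ⟨τ₀, hτ₀, fun s _ _ => not_lt.mp fun h => hne ⟨_, h⟩⟩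
  refine ⟨![σ, τ], fun j => ?_, fun t ht => ?_, fun t ht => ?_⟩
  · fin_cases j
    · exact hσ
    · exact hτ
  · exact (hτu _ (by simp) (by simpa using ht)).trans (hσu _ (by simp) (by simpa using hτ))
  · exact (hτu _ (by simp) (by simpa using hσ)).trans (hσu _ (by simp) (by simpa using ht))
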